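/- arXiv:2209.08839 — 2 statements merged into one kernel-verified Lean document; each statement's English description precedes it below -/
import Mathlib

section
/- Let p be an odd prime and let S = F_p[X]/(X³ − X), with v denoting the image of X in S. If θ is a ring automorphism of S, then θ(v) is one of the following six elements of S: v; −v; 1 − (1/2)v − (3/2)v²; 1 + (1/2)v − (3/2)v²; −1 + (1/2)v + (3/2)v²; −1 − (1/2)v + (3/2)v², where 1/2 and 3/2 denote the corresponding elements of F_p (2 is invertible in F_p since p is odd). -/
open Polynomial

/-- `S p` is the ring `F_p[X]/(X³ - X)`. -/
noncomputable abbrev S (p : ℕ) : Type := AdjoinRoot (X ^ 3 - X : (ZMod p)[X])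

/-- `v p` is the image of `X` in `S p`. -/
noncomputable abbrev v (p : ℕ) : S p := AdjoinRoot.root _

/-- The canonical embedding of `F_p` into `S p`. -/
noncomputable abbrev ofFp (p : ℕ) : ZMod p →+* S p := AdjoinRoot.of _

/-- The element `a + b·v + c·v²` of `S p`. -/
noncomputable def el (p : ℕ) (a b c : ZMod p) : S p :=
  ofFp p a + ofFp p b * v p + ofFp p c * (v p) ^ 2
/-- Evaluation `S p → F_p` at a root `t` of `X³ - X`. -/
noncomputable def evalAt (p : ℕ) (t : ZMod p) (ht : t ^ 3 = t) : S p →+* ZMod p :=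
  AdjoinRoot.lift (RingHom.id _) t (by simp [ht])

lemma evalAt_v (p : ℕ) (t : ZMod p) (ht : t ^ 3 = t) : evalAt p t ht (v p) = t :=
  AdjoinRoot.lift_root _

lemma evalAt_ofFp (p : ℕ) (t : ZMod p) (ht : t ^ 3 = t) (a : ZMod p) :
    evalAt p t ht (ofFp p a) = a :=
  AdjoinRoot.lift_of _

lemma evalAt_mk (p : ℕ) (t : ZMod p) (ht : t ^ 3 = t) (g : (ZMod p)[X]) :
    evalAt p t ht (AdjoinRoot.mk _ g) = g.eval t :=
  AdjoinRoot.lift_mk _ g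

lemma evalAt_el (p : ℕ) (t : ZMod p) (ht : t ^ 3 = t) (a b c : ZMod p) :
    evalAt p t ht (el p a b c) = a + b * t + c * t ^ 2 := by
  simp only [el, map_add, map_mul, map_pow, evalAt_v, evalAt_ofFp]

lemma v_pow_three (p : ℕ) : v p ^ 3 = v p := by
  have h : AdjoinRoot.mk (X ^ 3 - X : (ZMod p)[X]) (X ^ 3 - X) = 0 := AdjoinRoot.mk_self
  rw [map_sub, map_pow, AdjoinRoot.mk_X] at h
  exact sub_eq_zero.mp h

/-- Ring homomorphisms from `S p` to `F_p` are determined by the image of `v`. -/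
lemma ringHom_ext_v (p : ℕ) (f g : S p →+* ZMod p) (h : f (v p) = g (v p)) : f = g :=
  AdjoinRoot.ringHom_ext (Subsingleton.elim _ _) h

lemma evalAt_equiv_v_injective (p : ℕ) (θ : S p ≃+* S p) {s t : ZMod p}
    (hs : s ^ 3 = s) (ht : t ^ 3 = t)
    (h : evalAt p s hs (θ (v p)) = evalAt p t ht (θ (v p))) : s = t := by
  have key := ringHom_ext_v p ((evalAt p s hs).comp (θ : S p →+* S p))
    ((evalAt p t ht).comp (θ : S p →+* S p)) h
  have := RingHom.congr_fun key (θ.symm (v p))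
  simpa [evalAt_v] using this

/-- An element of `S p` is determined by its values at `0`, `1` and `-1`. -/
lemma eq_of_evalAt_eq (p : ℕ) [Fact p.Prime] (h2 : (2 : ZMod p) ≠ 0) {x y : S p}
    (h : ∀ t ht, evalAt p t ht x = evalAt p t ht y) : x = y := by
  obtain ⟨f, rfl⟩ := AdjoinRoot.mk_surjective x
  obtain ⟨g, rfl⟩ := AdjoinRoot.mk_surjective y
  rw [AdjoinRoot.mk_eq_mk]
  have hdvd (t : ZMod p) (ht : t ^ 3 = t) : X - C t ∣ f - g := by
    have := h t ht
    rw [evalAt_mk, evalAt_mk] at this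
    rw [dvd_iff_isRoot, IsRoot.def, eval_sub, this, sub_self]
  have hcop {s t : ZMod p} (hst : s - t ≠ 0) : IsCoprime (X - C s) (X - C t) :=
    isCoprime_X_sub_C_of_isUnit_sub hst.isUnit
  have hfac : (X ^ 3 - X : (ZMod p)[X]) = (X - C 0) * (X - C 1) * (X - C (-1)) := by
    simp only [map_zero, map_one, map_neg]
    ring
  rw [hfac]
  refine IsCoprime.mul_dvd (IsCoprime.mul_left (hcop (by simp)) (hcop ?_))
    (IsCoprime.mul_dvd (hcop (by simp)) (hdvd 0 (by ring)) (hdvd 1 (by ring)))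
    (hdvd (-1) (by ring))
  rwa [sub_neg_eq_add, one_add_one_eq_two]

lemma eq_zero_or_one_or_neg_one_of_pow_three {R : Type*} [CommRing R] [IsDomain R] {a : R}
    (h : a ^ 3 = a) : a = 0 ∨ a = 1 ∨ a = -1 := by
  have : a * ((a - 1) * (a + 1)) = 0 := by linear_combination h
  simpa only [mul_eq_zero, sub_eq_zero, add_eq_zero_iff_eq_neg] using this

theorem aut_apply_v_cases (p : ℕ) (hp : p.Prime) (hodd : Odd p) (θ : S p ≃+* S p) :
    θ (v p) = v p ∨
    θ (v p) = -v p ∨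
    θ (v p) = el p 1 (-(2⁻¹ : ZMod p)) (-(3 * 2⁻¹)) ∨
    θ (v p) = el p 1 (2⁻¹ : ZMod p) (-(3 * 2⁻¹)) ∨
    θ (v p) = el p (-1) (2⁻¹ : ZMod p) (3 * 2⁻¹) ∨
    θ (v p) = el p (-1) (-(2⁻¹ : ZMod p)) (3 * 2⁻¹) := by
  have : Fact p.Prime := ⟨hp⟩
  have h2 : (2 : ZMod p) ≠ 0 := by
    have : Fact (2 < p) := ⟨by
      have := hp.two_le
      rcases hodd with ⟨k, rfl⟩
      omega⟩
    exact fun h => ZMod.neg_one_ne_one (n := p) (by linear_combination -h)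
  have hhalf : (2 : ZMod p) * 2⁻¹ = 1 := mul_inv_cancel₀ h2
  have h0 : (0 : ZMod p) ^ 3 = 0 := by ring
  have h1 : (1 : ZMod p) ^ 3 = 1 := by ring
  have hm : (-1 : ZMod p) ^ 3 = -1 := by ring
  have h01 := mt (evalAt_equiv_v_injective p θ h0 h1) zero_ne_one
  have h0m := mt (evalAt_equiv_v_injective p θ h0 hm) (by simp)
  have h1m := mt (evalAt_equiv_v_injective p θ h1 hm)
    fun h => h2 (by linear_combination h)
  have hval (t : ZMod p) (ht : t ^ 3 = t) := eq_zero_or_one_or_neg_one_of_pow_three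
    (a := evalAt p t ht (θ (v p))) (by rw [← map_pow, ← map_pow, v_pow_three])
  have hext {y : S p} (e0 : evalAt p 0 h0 (θ (v p)) = evalAt p 0 h0 y)
      (e1 : evalAt p 1 h1 (θ (v p)) = evalAt p 1 h1 y)
      (em : evalAt p (-1) hm (θ (v p)) = evalAt p (-1) hm y) : θ (v p) = y :=
    eq_of_evalAt_eq p h2 fun t ht => by
      rcases eq_zero_or_one_or_neg_one_of_pow_three ht with rfl | rfl | rfl <;> assumption
  rcases hval 0 h0 with a | a | a <;> rcases hval 1 h1 with b | b | b <;>
    rcases hval (-1) hm with c | c | c <;>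
    first
    | exact absurd (a.trans b.symm) h01
    | exact absurd (a.trans c.symm) h0m
    | exact absurd (b.trans c.symm) h1m
    | skip
  · exact .inl (hext (by rw [a, evalAt_v]) (by rw [b, evalAt_v]) (by rw [c, evalAt_v]))
  · exact .inr <| .inl <| hext (by rw [a, map_neg, evalAt_v, neg_zero])
      (by rw [b, map_neg, evalAt_v]) (by rw [c, map_neg, evalAt_v, neg_neg])
  · refine .inr <| .inr <| .inr <| .inl <| hext ?_ ?_ ?_ <;> simp only [a, b, c, evalAt_el] <;> grind
  · refine .inr <| .inr <| .inl <| hext ?_ ?_ ?_ <;> simp only [a, b, c, evalAt_el] <;> grind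
  · refine .inr <| .inr <| .inr <| .inr <| .inr <| hext ?_ ?_ ?_ <;> simp only [a, b, c, evalAt_el] <;> grind
  · refine .inr <| .inr <| .inr <| .inr <| .inl <| hext ?_ ?_ ?_ <;> simp only [a, b, c, evalAt_el] <;> grind
end

section
/- Let p be an odd prime and let S = F_p[X]/(X³ − X), with v denoting the image of X in S. The group of ring automorphisms of S has exactly six elements. -/
open Polynomial

/-- Every ring homomorphism from a finite power of `F_p` to `F_p` is a coordinate projection. -/
theorem exists_eq_evalRingHom {ι : Type*} [Finite ι] {p : ℕ} [Fact p.Prime]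
    (φ : (ι → ZMod p) →+* ZMod p) : ∃ i, φ = Pi.evalRingHom (fun _ => ZMod p) i := by
  classical
  cases nonempty_fintype ι
  have hsum : ∑ i, φ (Pi.single i 1) = 1 := by
    rw [← map_sum, show ∑ i, Pi.single i (1 : ZMod p) = 1 from
      Finset.univ_sum_single (1 : ι → ZMod p), map_one]
  obtain ⟨i, -, hi⟩ : ∃ i ∈ Finset.univ, φ (Pi.single i 1) ≠ 0 :=
    Finset.exists_ne_zero_of_sum_ne_zero (by rw [hsum]; exact one_ne_zero)
  refine ⟨i, RingHom.ext fun f => mul_right_cancel₀ hi ?_⟩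
  have hf : f * Pi.single i 1 = Pi.constRingHom ι (ZMod p) (f i) * Pi.single i 1 := by
    ext j
    rcases eq_or_ne j i with rfl | hj
    · simp
    · simp [hj]
  have hconst : φ.comp (Pi.constRingHom ι (ZMod p)) = RingHom.id _ := Subsingleton.elim _ _
  rw [← map_mul, hf, map_mul]
  exact congrArg (· * _) (RingHom.congr_fun hconst (f i))

/-- The ring automorphisms of a finite power of `F_p` are as many as the permutations of its
coordinates. -/
theorem card_ringAut_pi_zmod (ι : Type*) [Finite ι] (p : ℕ) [Fact p.Prime] :
    Nat.card ((ι → ZMod p) ≃+* (ι → ZMod p)) = Nat.card (Equiv.Perm ι) := by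
  classical
  refine (Nat.card_congr (Equiv.ofBijective
    (fun σ : Equiv.Perm ι => RingEquiv.piCongrLeft' (fun _ => ZMod p) σ) ⟨?_, ?_⟩)).symm
  · intro σ τ h
    ext i
    have hi := congrFun (RingEquiv.congr_fun h (Pi.single i 1)) (σ i)
    by_contra hne
    have hne' : τ.symm (σ i) ≠ i := fun h' => hne (by rw [← h', Equiv.apply_symm_apply, h'])
    simp [RingEquiv.piCongrLeft', Equiv.piCongrLeft', hne'] at hi
  · intro e
    choose σ hσ using fun j =>
      exists_eq_evalRingHom ((Pi.evalRingHom (fun _ => ZMod p) j).comp e.toRingHom)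
    have he (f : ι → ZMod p) (j : ι) : e f j = f (σ j) := RingHom.congr_fun (hσ j) f
    have hinj : Function.Injective σ := by
      intro j k hjk
      by_contra hne
      obtain ⟨f, hf⟩ := e.surjective (Pi.single j 1)
      have hj := he f j
      rw [hjk, ← he f k, hf] at hj
      simp [Ne.symm hne] at hj
    refine ⟨(Equiv.ofBijective σ (Finite.injective_iff_bijective.mp hinj)).symm,
      RingEquiv.ext fun f => funext fun j => ?_⟩
    rw [he]
    rfl

/-- Evaluation of the elements of `S p` at `0`, `1` and `-1`. -/
noncomputable def evalHom (p : ℕ) : S p →+* (Fin 3 → ZMod p) :=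
  AdjoinRoot.lift (Pi.constRingHom (Fin 3) (ZMod p)) ![0, 1, -1] (by
    ext i
    fin_cases i <;> simp
    ring)

theorem evalHom_mk (p : ℕ) (f : (ZMod p)[X]) (i : Fin 3) :
    evalHom p (AdjoinRoot.mk _ f) i = f.eval ((![0, 1, -1] : Fin 3 → ZMod p) i) := by
  rw [evalHom, AdjoinRoot.lift_mk]
  exact hom_eval₂ f _ (Pi.evalRingHom (fun _ => ZMod p) i) _

theorem evalHom_bijective (p : ℕ) [Fact p.Prime] (hodd : Odd p) :
    Function.Bijective (evalHom p) := by
  have h2 : (2 : ZMod p) ≠ 0 :=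
    Ring.two_ne_zero (by rw [ZMod.ringChar_zmod_n]; rintro rfl; exact absurd hodd (by decide))
  constructor
  · rw [injective_iff_map_eq_zero]
    intro x hx
    obtain ⟨f, rfl⟩ := AdjoinRoot.mk_surjective x
    have hroot (i : Fin 3) : X - C ((![0, 1, -1] : Fin 3 → ZMod p) i) ∣ f := by
      rw [dvd_iff_isRoot, IsRoot.def, ← evalHom_mk, hx, Pi.zero_apply]
    have hinj : Function.Injective (![0, 1, -1] : Fin 3 → ZMod p) := by
      intro i j h
      fin_cases i <;> fin_cases j <;> simp at h ⊢ <;> grind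
    have hdvd := Fintype.prod_dvd_of_coprime (pairwise_coprime_X_sub_C hinj) hroot
    rw [AdjoinRoot.mk_eq_zero]
    convert hdvd using 1
    simp [Fin.prod_univ_three]
    ring
  · intro g
    refine ⟨AdjoinRoot.mk _ (C (g 0) + C ((g 1 - g 2) / 2) * X +
      C ((g 1 + g 2) / 2 - g 0) * X ^ 2), funext fun i => ?_⟩
    rw [evalHom_mk]
    fin_cases i <;> simp <;> field_simp <;> ring

theorem card_ringAut_eq_six (p : ℕ) (hp : p.Prime) (hodd : Odd p) :
    Nat.card (S p ≃+* S p) = 6 := by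
  have : Fact p.Prime := ⟨hp⟩
  let e := RingEquiv.ofBijective (evalHom p) (evalHom_bijective p hodd)
  let conj : (S p ≃+* S p) ≃ ((Fin 3 → ZMod p) ≃+* (Fin 3 → ZMod p)) :=
    { toFun := fun a => (e.symm.trans a).trans e
      invFun := fun b => (e.trans b).trans e.symm
      left_inv := fun a => by ext; simp
      right_inv := fun b => by ext; simp }
  rw [Nat.card_congr conj, card_ringAut_pi_zmod, Nat.card_perm, Nat.card_fin]
  rfl
end
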